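/- arXiv:1305.2743 — 2 statements merged into one kernel-verified Lean document; each statement's English description precedes it below -/
import Mathlib

section
/- Let G be a finite simple graph, F a set of edges of G, and suppose G \ F is bipartite. If F is a minimal edge set with this property, then contracting each connected component of G[F] to a single vertex yields a bipartite graph; in particular there is a set of edges of size r(F) whose contraction makes G bipartite. -/
/-- The set of vertices spanned by an edge set (endpoints of its edges). -/
def esupp {V : Type*} (F : Set (Sym2 V)) : Set V := {v | ∃ e ∈ F, v ∈ e}

/-- The number of connected components of the graph with edge set `F`
that meet the vertex set `S`. -/
noncomputable def ncomp {V : Type*} (F : Set (Sym2 V)) (S : Set V) : ℕ :=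
  Nat.card {c : (SimpleGraph.fromEdgeSet F).ConnectedComponent //
    ∃ v ∈ S, (SimpleGraph.fromEdgeSet F).connectedComponentMk v = c}

/-- The rank of an edge set `F`: number of vertices spanned by `F` minus the
number of connected components of the graph `G[F]` (vertex set `esupp F`, edge set `F`). -/
noncomputable def erank {V : Type*} (F : Set (Sym2 V)) : ℕ :=
  Nat.card (esupp F) - ncomp F (esupp F)

/-- The graph `G/F` obtained by contracting all edges of `F`: its vertices are the
connected components of the graph with edge set `F`, two components adjacent if
`G` has an edge between them. -/
def contractE {V : Type*} (G : SimpleGraph V) (F : Set (Sym2 V)) :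
    SimpleGraph ((SimpleGraph.fromEdgeSet F).ConnectedComponent) :=
  SimpleGraph.fromRel fun a b =>
    ∃ u v, G.Adj u v ∧ (SimpleGraph.fromEdgeSet F).connectedComponentMk u = a ∧
      (SimpleGraph.fromEdgeSet F).connectedComponentMk v = b

open SimpleGraph

/-- A colouring that is constant on the edges of `F` and proper on the edges of `G` joining
different components of `F` descends to the contraction. -/
theorem contractE_colorable_of_map {V : Type*} {G : SimpleGraph V} {F : Set (Sym2 V)} {n : ℕ}
    (c : V → Fin n) (hconst : ∀ u v, (fromEdgeSet F).Reachable u v → c u = c v)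
    (hproper : ∀ u v, G.Adj u v → ¬ (fromEdgeSet F).Reachable u v → c u ≠ c v) :
    (contractE G F).Colorable n := by
  refine ⟨Coloring.mk (fun K => K.lift c fun u v p _ => hconst u v p.reachable) ?_⟩
  intro a b hab
  obtain ⟨hne, ⟨u, v, huv, rfl, rfl⟩ | ⟨u, v, huv, rfl, rfl⟩⟩ := hab
  · exact hproper u v huv fun h => hne (ConnectedComponent.sound h)
  · exact (hproper u v huv fun h => hne (ConnectedComponent.sound h).symm).symm

/-- If `F` is minimal with `G \ F` properly coloured by `c`, then `c` is constant on each edge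
of `F`. -/
theorem eq_of_mem_of_minimal {V : Type*} {G : SimpleGraph V} {F : Set (Sym2 V)} {n : ℕ}
    (hmin : ∀ F'' ⊂ F, ¬ (G.deleteEdges F'').Colorable n)
    (c : (G.deleteEdges F).Coloring (Fin n)) {u v : V} (huv : s(u, v) ∈ F) : c u = c v := by
  by_contra hne
  refine hmin (F \ {s(u, v)}) (Set.sdiff_singleton_ssubset.2 huv) ⟨Coloring.mk c ?_⟩
  intro x y hxy
  rw [deleteEdges_adj] at hxy
  by_cases hF : s(x, y) ∈ F
  · have he : s(x, y) = s(u, v) := by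
      by_contra h
      exact hxy.2 ⟨hF, h⟩
    rcases Sym2.eq_iff.1 he with ⟨rfl, rfl⟩ | ⟨rfl, rfl⟩
    · exact hne
    · exact Ne.symm hne
  · exact c.valid (deleteEdges_adj.2 ⟨hxy.1, hF⟩)

/-- The component representative of a vertex. -/
noncomputable def componentRoot {V : Type*} (H : SimpleGraph V) (v : V) : V :=
  (H.connectedComponentMk v).out

theorem reachable_componentRoot {V : Type*} (H : SimpleGraph V) (v : V) :
    H.Reachable v (componentRoot H v) :=
  ConnectedComponent.exact (Quot.out_eq (H.connectedComponentMk v)).symm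

theorem componentRoot_eq {V : Type*} {H : SimpleGraph V} {u v : V} (h : H.Reachable u v) :
    componentRoot H u = componentRoot H v := by
  rw [componentRoot, ConnectedComponent.sound h, componentRoot]

theorem exists_adj_dist_componentRoot_lt {V : Type*} {H : SimpleGraph V} {v : V}
    (hv : componentRoot H v ≠ v) :
    ∃ u, H.Adj v u ∧ H.dist u (componentRoot H u) < H.dist v (componentRoot H v) := by
  obtain ⟨p, hp⟩ := (reachable_componentRoot H v).exists_walk_length_eq_dist
  generalize hr : componentRoot H v = r at *
  cases p with
  | nil => exact absurd rfl hv
  | cons h q =>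
    refine ⟨_, h, ?_⟩
    rw [← componentRoot_eq h.reachable, hr, ← hp, Walk.length_cons]
    exact Nat.lt_succ_of_le (dist_le q)

/-- Every graph has a spanning set of edges in bijection with the vertices that are not component
representatives. -/
theorem exists_spanning_edges {V : Type*} (H : SimpleGraph V) :
    ∃ F₀ ⊆ H.edgeSet, Nat.card F₀ = Nat.card {v | componentRoot H v ≠ v} ∧
      ∀ u v, (fromEdgeSet F₀).Reachable u v ↔ H.Reachable u v := by
  choose p hadj hlt using fun v : {v | componentRoot H v ≠ v} =>
    exists_adj_dist_componentRoot_lt v.2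
  let f : {v | componentRoot H v ≠ v} → Sym2 V := fun v => s(v.1, p v)
  have hinj : Function.Injective f := by
    intro v w h
    rcases Sym2.eq_iff.1 h with ⟨h, -⟩ | ⟨h₁, h₂⟩
    · exact Subtype.ext h
    · have hv := hlt v
      have hw := hlt w
      rw [h₂] at hv
      rw [← h₁] at hw
      exact absurd hv hw.not_gt
  have hsub : Set.range f ⊆ H.edgeSet := by
    rintro _ ⟨v, rfl⟩
    exact hadj v
  have hroot : ∀ n v, H.dist v (componentRoot H v) = n →
      (fromEdgeSet (Set.range f)).Reachable v (componentRoot H v) := by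
    intro n
    induction n using Nat.strong_induction_on with
    | _ n ih =>
      intro v hn
      by_cases hv : componentRoot H v = v
      · rw [hv]
      · have h₁ : (fromEdgeSet (Set.range f)).Adj v (p ⟨v, hv⟩) :=
          (fromEdgeSet_adj _).2 ⟨⟨⟨v, hv⟩, rfl⟩, (hadj ⟨v, hv⟩).ne⟩
        have h₂ := ih _ (hn ▸ hlt ⟨v, hv⟩) _ rfl
        rw [← componentRoot_eq (hadj ⟨v, hv⟩).reachable] at h₂
        exact h₁.reachable.trans h₂
  refine ⟨Set.range f, hsub, Nat.card_range_of_injective hinj, fun u v => ⟨fun h => ?_, fun h => ?_⟩⟩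
  · refine h.mono fun x y hxy => hsub ((fromEdgeSet_adj _).1 hxy).1
  · have hu := hroot _ u rfl
    rw [componentRoot_eq h] at hu
    exact hu.trans (hroot _ v rfl).symm

theorem mem_esupp_of_adj {V : Type*} {F : Set (Sym2 V)} {u v : V}
    (h : (fromEdgeSet F).Adj u v) : u ∈ esupp F :=
  ⟨s(u, v), ((fromEdgeSet_adj _).1 h).1, Sym2.mem_mk_left u v⟩

theorem mem_esupp_of_reachable {V : Type*} {F : Set (Sym2 V)} {u v : V}
    (h : (fromEdgeSet F).Reachable u v) (hu : u ∈ esupp F) : v ∈ esupp F := by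
  obtain ⟨p⟩ := h.symm
  cases p with
  | nil => exact hu
  | cons h _ => exact mem_esupp_of_adj h

/-- The components meeting the support of `F` are counted by their representatives. -/
theorem ncomp_esupp_eq {V : Type*} (F : Set (Sym2 V)) :
    ncomp F (esupp F) =
      Nat.card {v | v ∈ esupp F ∧ componentRoot (fromEdgeSet F) v = v} := by
  symm
  refine Nat.card_congr (Equiv.ofBijective
    (fun v => ⟨(fromEdgeSet F).connectedComponentMk v.1, v.1, v.2.1, rfl⟩) ⟨?_, ?_⟩)
  · intro v w h
    have h' := componentRoot_eq (ConnectedComponent.exact (Subtype.ext_iff.1 h))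
    rw [v.2.2, w.2.2] at h'
    exact Subtype.ext h'
  · rintro ⟨_, v, hv, rfl⟩
    have hr := reachable_componentRoot (fromEdgeSet F) v
    exact ⟨⟨_, mem_esupp_of_reachable hr hv, (componentRoot_eq hr).symm⟩,
      Subtype.ext (ConnectedComponent.sound hr.symm)⟩

/-- The rank of `F` is the number of vertices that are not component representatives. -/
theorem erank_eq {V : Type*} [Finite V] (F : Set (Sym2 V)) :
    erank F = Nat.card {v | componentRoot (fromEdgeSet F) v ≠ v} := by
  have hdiff : {v | componentRoot (fromEdgeSet F) v ≠ v} =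
      esupp F \ {v | v ∈ esupp F ∧ componentRoot (fromEdgeSet F) v = v} := by
    ext v
    refine ⟨fun hv => ⟨?_, fun h => hv h.2⟩, fun hv h => hv.2 ⟨hv.1, h⟩⟩
    obtain ⟨u, hu, -⟩ := exists_adj_dist_componentRoot_lt hv
    exact mem_esupp_of_adj hu
  rw [erank, ncomp_esupp_eq, hdiff]
  simp only [Nat.card_coe_set_eq]
  exact (Set.ncard_sdiff (fun v hv => hv.1) (Set.toFinite _)).symm

/-- if `F` is a minimal edge set such that `G \ F` is bipartite, then
contracting each connected component of `G[F]` (i.e. contracting the edges of `F`)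
yields a bipartite graph; in particular there is an edge set of size `r(F)` whose
contraction makes `G` bipartite. -/
theorem stmt3 {V : Type*} [Fintype V] (G : SimpleGraph V) (F : Set (Sym2 V))
    (hF : F ⊆ G.edgeSet) (hbip : (G.deleteEdges F).Colorable 2)
    (hmin : ∀ F'' ⊂ F, ¬ (G.deleteEdges F'').Colorable 2) :
    (contractE G F).Colorable 2 ∧
    ∃ F₀ ⊆ G.edgeSet, Nat.card F₀ = erank F ∧ (contractE G F₀).Colorable 2 := by
  obtain ⟨c⟩ := hbip
  have hconst : ∀ u v, (fromEdgeSet F).Reachable u v → c u = c v := by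
    rintro u v ⟨p⟩
    induction p with
    | nil => rfl
    | cons h _ ih =>
      exact (eq_of_mem_of_minimal hmin c ((fromEdgeSet_adj _).1 h).1).trans ih
  have hproper : ∀ u v, G.Adj u v → ¬ (fromEdgeSet F).Reachable u v → c u ≠ c v := by
    intro u v huv hr
    refine c.valid (deleteEdges_adj.2 ⟨huv, fun h => hr ?_⟩)
    exact ((fromEdgeSet_adj _).2 ⟨h, huv.ne⟩).reachable
  refine ⟨contractE_colorable_of_map c hconst hproper, ?_⟩
  obtain ⟨F₀, hsub, hcard, hreach⟩ := exists_spanning_edges (fromEdgeSet F)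
  refine ⟨F₀, fun e he => hF ?_, hcard.trans (erank_eq F).symm,
    contractE_colorable_of_map c (fun u v h => hconst u v ((hreach u v).1 h))
      fun u v huv h => hproper u v huv fun h' => h ((hreach u v).2 h')⟩
  have := hsub he
  rw [edgeSet_fromEdgeSet] at this
  exact this.1
end

section
/- Let G be a finite graph, P = (V_1, …, V_ℓ) a partition of V(G) such that each induced subgraph G[V_i] is connected, and X, Y disjoint vertex sets. For Z ⊆ {1,…,ℓ}, let C_Z = ⋃_{i∈Z} E(G[V_i]). Construct G' from G by deleting all edges inside the parts, adding for each i a new vertex v_i adjacent to all vertices of V_i, and let S_Z = {v_i : i ∈ Z}. Then C_Z is an X–Y edge cut in G if and only if S_Z is an X–Y vertex separator in G' (i.e., G' − S_Z has no X–Y path). -/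
/-- `C` is an `X`–`Y` edge cut in `G`. -/
def IsEdgeCut {V : Type*} (G : SimpleGraph V) (X Y : Set V) (C : Set (Sym2 V)) : Prop :=
  ∀ x ∈ X, ∀ y ∈ Y, ¬ (G.deleteEdges C).Reachable x y

/-- `S` is an `X`–`Y` vertex separator in `H`: every walk from `X` to `Y` meets `S`. -/
def IsSeparator {W : Type*} (H : SimpleGraph W) (S X Y : Set W) : Prop :=
  ∀ x ∈ X, ∀ y ∈ Y, ∀ w : H.Walk x y, ∃ v ∈ w.support, v ∈ S

/-- The auxiliary graph `G'` of the partition given by `idx : V → ι`: delete all edges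
inside the parts, and add for each part index `i` a new vertex adjacent to all
vertices of that part. -/
def auxGraph {V ι : Type*} (G : SimpleGraph V) (idx : V → ι) : SimpleGraph (V ⊕ ι) :=
  SimpleGraph.fromRel fun a b =>
    match a, b with
    | Sum.inl u, Sum.inl v => G.Adj u v ∧ idx u ≠ idx v
    | Sum.inl u, Sum.inr i => idx u = i
    | _, _ => False

theorem auxGraph_adj_inl_inl {V ι : Type*} (G : SimpleGraph V) (idx : V → ι) (u v : V) :
    (auxGraph G idx).Adj (Sum.inl u) (Sum.inl v) ↔ G.Adj u v ∧ idx u ≠ idx v := by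
  simp only [auxGraph, SimpleGraph.fromRel_adj, ne_eq, Sum.inl.injEq]
  constructor
  · rintro ⟨-, h | h⟩
    · exact h
    · exact ⟨h.1.symm, fun e => h.2 e.symm⟩
  · exact fun h => ⟨h.1.ne, Or.inl h⟩

theorem auxGraph_adj_inl_inr {V ι : Type*} (G : SimpleGraph V) (idx : V → ι) (u : V) (i : ι) :
    (auxGraph G idx).Adj (Sum.inl u) (Sum.inr i) ↔ idx u = i := by
  simp [auxGraph]

theorem auxGraph_not_adj_inr_inr {V ι : Type*} (G : SimpleGraph V) (idx : V → ι) (i j : ι) :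
    ¬ (auxGraph G idx).Adj (Sum.inr i) (Sum.inr j) := by
  simp [auxGraph]

/-- The edges of `G` inside the parts with index in `Z`. -/
abbrev partEdges {V ι : Type*} (G : SimpleGraph V) (idx : V → ι) (Z : Set ι) : Set (Sym2 V) :=
  {e | e ∈ G.edgeSet ∧ ∃ i ∈ Z, ∀ v ∈ e, idx v = i}

theorem deleteEdges_partEdges_adj {V ι : Type*} (G : SimpleGraph V) (idx : V → ι) (Z : Set ι)
    (u v : V) : (G.deleteEdges (partEdges G idx Z)).Adj u v ↔
      G.Adj u v ∧ (idx u = idx v → idx u ∉ Z) := by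
  simp only [SimpleGraph.deleteEdges_adj, Set.mem_ofPred_eq, SimpleGraph.mem_edgeSet,
    Sym2.mem_iff, forall_eq_or_imp, forall_eq]
  grind

theorem reachable_of_idx_eq {V ι : Type*} {G : SimpleGraph V} {idx : V → ι} {Z : Set ι} {i : ι}
    (hconn : (G.induce {v | idx v = i}).Connected) (hi : i ∉ Z) {u v : V}
    (hu : idx u = i) (hv : idx v = i) :
    (G.deleteEdges (partEdges G idx Z)).Reachable u v := by
  let f : G.induce {v | idx v = i} →g G.deleteEdges (partEdges G idx Z) :=
    { toFun := Subtype.val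
      map_rel' := fun {a b} h =>
        (deleteEdges_partEdges_adj G idx Z a b).2 ⟨h, fun _ => by rwa [a.2]⟩ }
  exact (hconn.preconnected ⟨u, hu⟩ ⟨v, hv⟩).map f

/-- The vertices of `G` represented by a vertex of the auxiliary graph: a vertex of `G`
represents itself, and a part vertex represents its whole part. -/
def represented {V ι : Type*} (idx : V → ι) : V ⊕ ι → Set V
  | Sum.inl u => {u}
  | Sum.inr i => {v | idx v = i}

theorem reachable_of_auxGraph_walk {V ι : Type*} {G : SimpleGraph V} {idx : V → ι}
    (hconn : ∀ i, (G.induce {v | idx v = i}).Connected) {Z : Set ι} {a b : V ⊕ ι}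
    (w : (auxGraph G idx).Walk a b) (hw : ∀ i ∈ Z, Sum.inr i ∉ w.support) :
    ∀ u ∈ represented idx a, ∀ v ∈ represented idx b,
      (G.deleteEdges (partEdges G idx Z)).Reachable u v := by
  induction w with
  | @nil a =>
    rcases a with a | i
    · rintro u rfl v rfl
      exact .refl _
    · intro u hu v hv
      exact reachable_of_idx_eq (hconn i) (fun hi => hw i hi (by simp)) hu hv
  | @cons a c b h w ih =>
    have ih := ih fun i hi hc => hw i hi (by simp [hc])
    intro u hu v hv
    rcases a with a | i <;> rcases c with c | j
    · obtain rfl : u = a := hu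
      have h := (auxGraph_adj_inl_inl G idx u c).1 h
      have hadj := (deleteEdges_partEdges_adj G idx Z u c).2 ⟨h.1, fun e => absurd e h.2⟩
      exact hadj.reachable.trans (ih c rfl v hv)
    · obtain rfl : u = a := hu
      exact ih u ((auxGraph_adj_inl_inr G idx u j).1 h) v hv
    · have hi : i ∉ Z := fun hi => hw i hi (by simp)
      have hc := (auxGraph_adj_inl_inr G idx c i).1 h.symm
      exact (reachable_of_idx_eq (hconn i) hi hu hc).trans (ih c rfl v hv)
    · exact absurd h (auxGraph_not_adj_inr_inr G idx i j)

theorem exists_auxGraph_walk {V ι : Type*} {G : SimpleGraph V} {idx : V → ι} {Z : Set ι} {x y : V}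
    (w : (G.deleteEdges (partEdges G idx Z)).Walk x y) :
    ∃ p : (auxGraph G idx).Walk (Sum.inl x) (Sum.inl y), ∀ i ∈ Z, Sum.inr i ∉ p.support := by
  induction w with
  | nil => exact ⟨.nil, by simp⟩
  | @cons u v y h w ih =>
    obtain ⟨p, hp⟩ := ih
    obtain ⟨hadj, hZ⟩ := (deleteEdges_partEdges_adj G idx Z u v).1 h
    by_cases huv : idx u = idx v
    · refine ⟨.cons ((auxGraph_adj_inl_inr G idx u _).2 rfl)
        (.cons ((auxGraph_adj_inl_inr G idx v _).2 huv.symm).symm p), fun i hi => ?_⟩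
      have hne : i ≠ idx u := fun e => hZ huv (e ▸ hi)
      simp [hp i hi, hne]
    · exact ⟨.cons ((auxGraph_adj_inl_inl G idx u v).2 ⟨hadj, huv⟩) p, fun i hi => by
        simp [hp i hi]⟩

/-- with each part `V_i = idx⁻¹(i)` inducing a connected subgraph,
for `Z ⊆ ι` the edge set `C_Z` (edges inside parts with index in `Z`) is an `X`–`Y`
edge cut in `G` iff `S_Z = {v_i : i ∈ Z}` is an `X`–`Y` vertex separator in the
auxiliary graph `G'`. -/
theorem stmt12 {V ι : Type*} [Fintype V] [Fintype ι] (G : SimpleGraph V) (idx : V → ι)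
    (hconn : ∀ i, (G.induce {v | idx v = i}).Connected)
    (X Y : Set V) (hd : Disjoint X Y) (Z : Set ι) :
    IsEdgeCut G X Y {e | e ∈ G.edgeSet ∧ ∃ i ∈ Z, ∀ v ∈ e, idx v = i} ↔
    IsSeparator (auxGraph G idx) {a | ∃ i ∈ Z, a = Sum.inr i}
      (Sum.inl '' X) (Sum.inl '' Y) := by
  constructor
  · rintro hcut _ ⟨x, hx, rfl⟩ _ ⟨y, hy, rfl⟩ w
    by_contra! hw
    exact hcut x hx y hy (reachable_of_auxGraph_walk hconn w
      (fun i hi hmem => hw _ hmem ⟨i, hi, rfl⟩) x rfl y rfl)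
  · rintro hsep x hx y hy ⟨w⟩
    obtain ⟨p, hp⟩ := exists_auxGraph_walk w
    obtain ⟨_, hmem, i, hi, rfl⟩ := hsep _ ⟨x, hx, rfl⟩ _ ⟨y, hy, rfl⟩ p
    exact hp i hi hmem
end
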